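/- Let G = (V,E) be a connected graph on n ≥ 3 vertices with adjacency matrix Γ over GF(2), and |G⟩ the corresponding graph state with stabilizer S; let δ(|G⟩) := min{wt(g) : g ∈ S, g ≠ I}. For A ⊆ V let Γ⟨A⟩ := (Γ_{ab})_{a∈A, b∈V∖A}. Then δ(|G⟩) equals the smallest cardinality |A| of a subset A ⊆ V such that |A| > rank₂ Γ⟨A⟩, where rank₂ denotes matrix rank over GF(2). -/

import Mathlib

open Matrix BigOperators
open scoped Classical

noncomputable section

/-- The state space of `n` qubits, `(ℂ²)^{⊗n}`, realized as functions from bit strings to `ℂ`. -/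
abbrev QState (n : ℕ) : Type := (Fin n → Fin 2) → ℂ

/-- Operators on `n` qubits. -/
abbrev QOp (n : ℕ) : Type := Matrix (Fin n → Fin 2) (Fin n → Fin 2) ℂ

/-- The single qubit Pauli matrices: `0 ↦ σ₀ = I`, `1 ↦ σ_x`, `2 ↦ σ_y`, `3 ↦ σ_z`. -/
def pauli1 (k : Fin 4) : Matrix (Fin 2) (Fin 2) ℂ :=
  if k = 0 then 1
  else if k = 1 then !![0, 1; 1, 0]
  else if k = 2 then !![0, -Complex.I; Complex.I, 0]
  else !![1, 0; 0, -1]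

/-- The `n`-qubit Pauli operator `σ_{f 0} ⊗ σ_{f 1} ⊗ ⋯ ⊗ σ_{f (n-1)}`. -/
def pauliOp {n : ℕ} (f : Fin n → Fin 4) : QOp n :=
  Matrix.of fun v w => ∏ i, pauli1 (f i) (v i) (w i)

/-- The support of a Pauli operator: the qubits on which it acts nontrivially. -/
def pSupport {n : ℕ} (f : Fin n → Fin 4) : Finset (Fin n) :=
  Finset.univ.filter fun i => f i ≠ 0

/-- The weight of a Pauli operator: the number of qubits on which it acts nontrivially. -/
def pWeight {n : ℕ} (f : Fin n → Fin 4) : ℕ := (pSupport f).card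

/-- `g` is the signed Pauli operator `±σ_f`. -/
def IsSignedPauli {n : ℕ} (g : QOp n) (f : Fin n → Fin 4) : Prop :=
  g = pauliOp f ∨ g = -pauliOp f

/-- The squared norm `∑_v |ψ_v|²` of an `n`-qubit state. -/
def qNormSq {n : ℕ} (ψ : QState n) : ℝ := ∑ v, Complex.normSq (ψ v)

/-- The inner product `⟨φ|ψ⟩` (antilinear in the first argument). -/
def qInner {n : ℕ} (φ ψ : QState n) : ℂ := ∑ v, starRingEnd ℂ (φ v) * ψ v

/-- The graph state correlation operator `K_a = σ_x^(a) ∏_{b ∈ N(a)} σ_z^(b)`. -/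
def Kop {n : ℕ} (G : SimpleGraph (Fin n)) [DecidableRel G.Adj] (a : Fin n) : QOp n :=
  pauliOp fun b => if b = a then 1 else if G.Adj a b then 3 else 0

/-- `ψ` is the graph state `|G⟩`: a unit vector fixed by all correlation operators `K_a`. -/
def IsGraphState {n : ℕ} (G : SimpleGraph (Fin n)) [DecidableRel G.Adj] (ψ : QState n) : Prop :=
  qNormSq ψ = 1 ∧ ∀ a : Fin n, Kop G a *ᵥ ψ = ψ

/-- The stabilizer of `ψ`: all signed Pauli operators `g = ±σ` with `g ψ = ψ`. -/
def stab {n : ℕ} (ψ : QState n) : Set (QOp n) :=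
  {g | (∃ f, IsSignedPauli g f) ∧ g *ᵥ ψ = ψ}

/-- The stabilizer elements of weight at most `d`. -/
def stabW {n : ℕ} (ψ : QState n) (d : ℕ) : Set (QOp n) :=
  {g | g ∈ stab ψ ∧ ∃ f, IsSignedPauli g f ∧ pWeight f ≤ d}

/-- `S_d`: the subgroup of the stabilizer generated by all elements of weight at most `d`,
as a set of operators.  (Since the stabilizer is a finite group, the generated submonoid
coincides with the generated subgroup.) -/
def SdSet {n : ℕ} (ψ : QState n) (d : ℕ) : Set (QOp n) :=
  (Submonoid.closure (stabW ψ d) : Set (QOp n))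

/-- `δ(|ψ⟩)`: the minimal weight of a nonidentity element of the stabilizer of `ψ`. -/
def deltaG {n : ℕ} (ψ : QState n) : ℕ :=
  sInf {d | ∃ g ∈ stab ψ, g ≠ 1 ∧ ∃ f, IsSignedPauli g f ∧ pWeight f = d}

/-- `η(|ψ⟩)`: the minimal `d` such that `S_d = S`. -/
def etaG {n : ℕ} (ψ : QState n) : ℕ :=
  sInf {d | stab ψ ⊆ SdSet ψ d}

/-- A `d`-body Hamiltonian on `n` qubits: a real linear combination of Pauli operators
of weight at most `d`. -/
def IsDBody {n : ℕ} (d : ℕ) (H : QOp n) : Prop :=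
  ∃ h : (Fin n → Fin 4) → ℝ, (∀ f, d < pWeight f → h f = 0) ∧
    H = ∑ f : Fin n → Fin 4, (h f : ℂ) • pauliOp f

/-- A Hamiltonian is nontrivial if it is nonzero and not a multiple of the identity. -/
def NontrivialHam {n : ℕ} (H : QOp n) : Prop :=
  H ≠ 0 ∧ ∀ c : ℂ, H ≠ c • (1 : QOp n)

/-- `φ` is an eigenvector of `H` with (real) eigenvalue `E`. -/
def IsEigenpair {n : ℕ} (H : QOp n) (E : ℝ) (φ : QState n) : Prop :=
  φ ≠ 0 ∧ H *ᵥ φ = (E : ℂ) • φ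

/-- `ψ` is a ground state of `H` with ground energy `E`: an eigenvector for the smallest
eigenvalue `E` of `H`. -/
def IsGroundStateE {n : ℕ} (H : QOp n) (ψ : QState n) (E : ℝ) : Prop :=
  IsEigenpair H E ψ ∧ ∀ E' φ, IsEigenpair H E' φ → E ≤ E'

/-- `ψ` is a ground state of `H`. -/
def IsGroundState {n : ℕ} (H : QOp n) (ψ : QState n) : Prop :=
  ∃ E, IsGroundStateE H ψ E

/-- The dimension of the eigenspace of `H` for the eigenvalue `E` (the multiplicity of `E`). -/
def eigDim {n : ℕ} (H : QOp n) (E : ℝ) : ℕ :=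
  Module.finrank ℂ (Module.End.eigenspace (Matrix.mulVecLin H) ((E : ℂ)))


/-- The adjacency matrix of `G` over GF(2). -/
def adjMat2 {n : ℕ} (G : SimpleGraph (Fin n)) [DecidableRel G.Adj] :
    Matrix (Fin n) (Fin n) (ZMod 2) :=
  Matrix.of fun a b => if G.Adj a b then 1 else 0

/-- The off-diagonal block `Γ⟨A⟩ = (Γ_{ab})_{a ∈ A, b ∈ V∖A}` of the adjacency matrix. -/
def adjCut {n : ℕ} (G : SimpleGraph (Fin n)) [DecidableRel G.Adj] (A : Finset (Fin n)) :
    Matrix {a : Fin n // a ∈ A} {b : Fin n // b ∉ A} (ZMod 2) :=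
  Matrix.of fun a b => adjMat2 G a.val b.val

/-- Whether a Pauli matrix flips the qubit: its coordinate along `σ_x` modulo phases. -/
def xBit : Fin 4 → ZMod 2 := ![0, 1, 1, 0]

/-- The coordinate of a Pauli matrix along `σ_z` modulo phases. -/
def zBit : Fin 4 → ZMod 2 := ![0, 0, 1, 1]

/-- The sign character `a ↦ (-1)^a` of `ZMod 2`. -/
def signChar : AddChar (ZMod 2) ℂ where
  toFun a := if a = 0 then 1 else -1
  map_zero_eq_one' := by simp
  map_add_eq_mul' a b := by
    have hbit (t : ZMod 2) : t = 0 ∨ t = 1 := by revert t; decide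
    rcases hbit a with rfl | rfl <;> rcases hbit b with rfl | rfl <;>
      simp [show (1 : ZMod 2) + 1 = 0 from rfl]

lemma signChar_sum {ι : Type*} (s : Finset ι) (t : ι → ZMod 2) :
    signChar (∑ i ∈ s, t i) = ∏ i ∈ s, signChar (t i) :=
  map_prod signChar.toMonoidHom (fun i => Multiplicative.ofAdd (t i)) s

lemma eq_zero_iff_xBit_zBit (k : Fin 4) : k = 0 ↔ xBit k = 0 ∧ zBit k = 0 := by
  revert k; decide

lemma pauli1_mul_self (k : Fin 4) : pauli1 k * pauli1 k = 1 := by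
  fin_cases k <;> ext i j <;> fin_cases i <;> fin_cases j <;> simp [pauli1, Matrix.mul_apply]

lemma pauli1_mul (k l : Fin 4) :
    ∃ (c : ℂ) (m : Fin 4), pauli1 k * pauli1 l = c • pauli1 m ∧ xBit m = xBit k + xBit l := by
  refine ⟨!![1, 1, 1, 1; 1, 1, Complex.I, -Complex.I; 1, -Complex.I, 1, Complex.I;
    1, Complex.I, -Complex.I, 1] k l,
    !![0, 1, 2, 3; 1, 0, 3, 2; 2, 3, 0, 1; 3, 2, 1, 0] k l, ?_, by revert k l; decide⟩
  fin_cases k <;> fin_cases l <;> ext i j <;> fin_cases i <;> fin_cases j <;>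
    simp [pauli1, Matrix.mul_apply]

lemma pauli1_mul_comm (k l : Fin 4) :
    pauli1 k * pauli1 l =
      signChar (xBit k * zBit l + zBit k * xBit l) • (pauli1 l * pauli1 k) := by
  fin_cases k <;> fin_cases l <;> ext i j <;> fin_cases i <;> fin_cases j <;>
    simp [pauli1, Matrix.mul_apply, xBit, zBit, signChar, show (1 : ZMod 2) + 1 = 0 from rfl]

lemma pauli1_apply_self_of_xBit_ne_zero {k : Fin 4} (hk : xBit k ≠ 0) (i : Fin 2) :
    pauli1 k i i = 0 := by
  fin_cases k <;> fin_cases i <;> simp_all [pauli1, xBit]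

lemma pauliOp_mul_apply {n : ℕ} (f g : Fin n → Fin 4) (v w : Fin n → Fin 2) :
    (pauliOp f * pauliOp g) v w = ∏ i, (pauli1 (f i) * pauli1 (g i)) (v i) (w i) := by
  simp only [Matrix.mul_apply, pauliOp, Matrix.of_apply, ← Finset.prod_mul_distrib]
  rw [Finset.prod_univ_sum, Fintype.piFinset_univ]

lemma pauliOp_zero {n : ℕ} : pauliOp (0 : Fin n → Fin 4) = 1 := by
  ext v w
  simp [pauliOp, pauli1, Matrix.one_apply, Finset.prod_ite_zero, funext_iff]

lemma pauliOp_mul_self {n : ℕ} (f : Fin n → Fin 4) : pauliOp f * pauliOp f = 1 := by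
  ext v w
  simp [pauliOp_mul_apply, pauli1_mul_self, Matrix.one_apply, Finset.prod_ite_zero, funext_iff]

lemma pauliOp_mul {n : ℕ} (f g : Fin n → Fin 4) :
    ∃ (c : ℂ) (h : Fin n → Fin 4), pauliOp f * pauliOp g = c • pauliOp h ∧
      ∀ i, xBit (h i) = xBit (f i) + xBit (g i) := by
  choose c h hmul hx using fun i => pauli1_mul (f i) (g i)
  refine ⟨∏ i, c i, h, ?_, hx⟩
  ext v w
  rw [pauliOp_mul_apply]
  simp [hmul, pauliOp, Finset.prod_mul_distrib]

lemma pauliOp_mul_comm {n : ℕ} (f g : Fin n → Fin 4) :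
    pauliOp f * pauliOp g =
      signChar (∑ i, (xBit (f i) * zBit (g i) + zBit (f i) * xBit (g i))) •
        (pauliOp g * pauliOp f) := by
  ext v w
  rw [Matrix.smul_apply, pauliOp_mul_apply, pauliOp_mul_apply, signChar_sum,
    smul_eq_mul, ← Finset.prod_mul_distrib]
  refine Finset.prod_congr rfl fun i _ => ?_
  rw [pauli1_mul_comm, Matrix.smul_apply, smul_eq_mul]

lemma pauliOp_apply_self_of_xBit_ne_zero {n : ℕ} {f : Fin n → Fin 4} {i : Fin n}
    (hi : xBit (f i) ≠ 0) (v : Fin n → Fin 2) : pauliOp f v v = 0 :=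
  Finset.prod_eq_zero (Finset.mem_univ i) (pauli1_apply_self_of_xBit_ne_zero hi _)

/-- Pauli operators that fix a common nonzero vector up to a scalar commute. -/
lemma symplectic_eq_zero_of_eigenvector {n : ℕ} {ψ : QState n} (hψ : ψ ≠ 0)
    {f g : Fin n → Fin 4} {c : ℂ} (hc : c ≠ 0) (hf : pauliOp f *ᵥ ψ = c • ψ)
    (hg : pauliOp g *ᵥ ψ = ψ) :
    ∑ i, (xBit (f i) * zBit (g i) + zBit (f i) * xBit (g i)) = 0 := by
  have h := congrArg (· *ᵥ ψ) (pauliOp_mul_comm f g)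
  simp only [Matrix.smul_mulVec, ← Matrix.mulVec_mulVec, hf, hg, Matrix.mulVec_smul] at h
  by_contra hs
  have hsign : signChar (∑ i, (xBit (f i) * zBit (g i) + zBit (f i) * xBit (g i))) = -1 :=
    if_neg hs
  rw [hsign, neg_one_smul, eq_neg_iff_add_eq_zero, ← two_smul ℂ] at h
  simp_all

lemma IsGraphState.ne_zero {n : ℕ} {G : SimpleGraph (Fin n)} [DecidableRel G.Adj]
    {ψ : QState n} (hψ : IsGraphState G ψ) : ψ ≠ 0 := by
  rintro rfl
  simpa [qNormSq] using hψ.1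

/-- The `z` part of a stabilizer element of a graph state is `Γ` applied to its `x` part. -/
lemma IsGraphState.zBit_eq {n : ℕ} {G : SimpleGraph (Fin n)} [DecidableRel G.Adj]
    {ψ : QState n} (hψ : IsGraphState G ψ) {f : Fin n → Fin 4} {c : ℂ} (hc : c ≠ 0)
    (hf : pauliOp f *ᵥ ψ = c • ψ) (a : Fin n) :
    zBit (f a) = ∑ b, xBit (f b) * adjMat2 G a b := by
  have h := symplectic_eq_zero_of_eigenvector hψ.ne_zero hc hf (hψ.2 a)
  have hz (b : Fin n) : zBit (if b = a then 1 else if G.Adj a b then 3 else 0) =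
      adjMat2 G a b := by
    by_cases hb : b = a
    · subst hb; simp [adjMat2, zBit]
    · by_cases hab : G.Adj a b <;> simp [adjMat2, zBit, hb, hab]
  have hx (b : Fin n) : xBit (if b = a then 1 else if G.Adj a b then 3 else 0) =
      if b = a then 1 else 0 := by
    by_cases hb : b = a
    · simp [xBit, hb]
    · by_cases hab : G.Adj a b <;> simp [xBit, hb, hab]
  simp only [hz, hx, Finset.sum_add_distrib, mul_ite, mul_one, mul_zero,
    Finset.sum_ite_eq', Finset.mem_univ, if_true] at h
  rw [eq_comm, ← CharTwo.add_eq_zero]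
  exact h

lemma IsSignedPauli.mulVec_eq {n : ℕ} {ψ : QState n} {g : QOp n} {f : Fin n → Fin 4}
    (hgf : IsSignedPauli g f) (hg : g *ᵥ ψ = ψ) :
    ∃ c : ℂ, c ≠ 0 ∧ pauliOp f *ᵥ ψ = c • ψ := by
  rcases hgf with rfl | rfl
  · exact ⟨1, one_ne_zero, by simpa using hg⟩
  · refine ⟨-1, by simp, ?_⟩
    rw [Matrix.neg_mulVec] at hg
    rw [neg_one_smul, ← hg, neg_neg, hg]

/-- Every `x` part is realized by a Pauli operator fixing the graph state up to a scalar. -/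
lemma IsGraphState.exists_eigenoperator {n : ℕ} {G : SimpleGraph (Fin n)} [DecidableRel G.Adj]
    {ψ : QState n} (hψ : IsGraphState G ψ) (x : Fin n → ZMod 2) :
    ∃ (c : ℂ) (f : Fin n → Fin 4), c • (pauliOp f *ᵥ ψ) = ψ ∧ ∀ i, xBit (f i) = x i := by
  have hzero : ∃ (c : ℂ) (f : Fin n → Fin 4), c • (pauliOp f *ᵥ ψ) = ψ ∧
      ∀ i, xBit (f i) = (0 : Fin n → ZMod 2) i :=
    ⟨1, 0, by simp [pauliOp_zero], fun i => by simp [xBit]⟩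
  rw [← Finset.univ_sum_single x]
  refine Finset.sum_induction _ (fun x : Fin n → ZMod 2 => ∃ (c : ℂ) (f : Fin n → Fin 4),
    c • (pauliOp f *ᵥ ψ) = ψ ∧ ∀ i, xBit (f i) = x i) ?_ hzero ?_
  · rintro x y ⟨c, f, hf, hxf⟩ ⟨d, g, hg, hxg⟩
    obtain ⟨e, h, hmul, hxh⟩ := pauliOp_mul f g
    refine ⟨c * d * e, h, ?_, fun i => by rw [hxh, hxf, hxg, Pi.add_apply]⟩
    calc (c * d * e) • (pauliOp h *ᵥ ψ)
        = c • d • ((e • pauliOp h) *ᵥ ψ) := by rw [Matrix.smul_mulVec]; simp only [smul_smul, mul_assoc]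
      _ = c • (pauliOp f *ᵥ (d • (pauliOp g *ᵥ ψ))) := by
          rw [← hmul, ← Matrix.mulVec_mulVec, Matrix.mulVec_smul]
      _ = ψ := by rw [hg, hf]
  · intro a _
    obtain ha | ha : x a = 0 ∨ x a = 1 := by
      generalize x a = t
      revert t; decide
    · simpa [ha] using hzero
    · refine ⟨1, _, by rw [one_smul]; exact hψ.2 a, fun b => ?_⟩
      rw [ha]
      by_cases hb : b = a
      · subst hb; simp [xBit]
      · by_cases hab : G.Adj a b <;> simp [xBit, hb, hab]

lemma IsGraphState.exists_mem_stab {n : ℕ} {G : SimpleGraph (Fin n)} [DecidableRel G.Adj]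
    {ψ : QState n} (hψ : IsGraphState G ψ) (x : Fin n → ZMod 2) :
    ∃ (g : QOp n) (f : Fin n → Fin 4), g ∈ stab ψ ∧ IsSignedPauli g f ∧
      ∀ i, xBit (f i) = x i := by
  obtain ⟨c, f, hf, hx⟩ := hψ.exists_eigenoperator x
  have hsq : (c * c) • ψ = ψ := by
    calc (c * c) • ψ = c • (pauliOp f *ᵥ (c • (pauliOp f *ᵥ ψ))) := by
          rw [Matrix.mulVec_smul, Matrix.mulVec_mulVec, pauliOp_mul_self, Matrix.one_mulVec,
            smul_smul]
      _ = ψ := by rw [hf, hf]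
  have hc : c * c = 1 :=
    smul_left_injective ℂ hψ.ne_zero (by simpa using hsq)
  rcases mul_self_eq_one_iff.1 hc with rfl | rfl
  · exact ⟨_, f, ⟨⟨f, Or.inl rfl⟩, by simpa using hf⟩, Or.inl rfl, hx⟩
  · exact ⟨_, f, ⟨⟨f, Or.inr rfl⟩, by simpa [Matrix.neg_mulVec] using hf⟩, Or.inr rfl, hx⟩

/-- A stabilizer element of a graph state is nontrivial iff its `x` part is nonzero. -/
lemma IsGraphState.ne_one_iff {n : ℕ} {G : SimpleGraph (Fin n)} [DecidableRel G.Adj]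
    {ψ : QState n} (hψ : IsGraphState G ψ) {g : QOp n} {f : Fin n → Fin 4}
    (hg : g *ᵥ ψ = ψ) (hgf : IsSignedPauli g f) : g ≠ 1 ↔ ∃ i, xBit (f i) ≠ 0 := by
  constructor
  · intro hne
    by_contra! hx
    obtain ⟨c, hc, hf⟩ := hgf.mulVec_eq hg
    have hf0 : f = 0 := funext fun i =>
      (eq_zero_iff_xBit_zBit _).2 ⟨hx i, by simp [hψ.zBit_eq hc hf, hx]⟩
    rcases hgf with rfl | rfl
    · exact hne (by rw [hf0, pauliOp_zero])
    · rw [hf0, pauliOp_zero, Matrix.neg_mulVec, Matrix.one_mulVec, neg_eq_iff_add_eq_zero,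
        ← two_smul ℂ] at hg
      simp [hψ.ne_zero] at hg
  · rintro ⟨i, hi⟩ rfl
    have h0 := pauliOp_apply_self_of_xBit_ne_zero hi 0
    rcases hgf with h | h
    · simpa [h0] using congrFun (congrFun h 0) 0
    · simpa [h0] using congrFun (congrFun h 0) 0

lemma rank_lt_card_iff_exists_vecMul_eq_zero {m n K : Type*} [Fintype m] [Fintype n] [Field K]
    (M : Matrix m n K) : M.rank < Fintype.card m ↔ ∃ y, y ≠ 0 ∧ y ᵥ* M = 0 := by
  have hind : ¬ (M.rank < Fintype.card m) ↔ LinearIndependent K M.row := by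
    rw [linearIndependent_iff_card_eq_finrank_span, Set.finrank, ← M.rank_eq_finrank_span_row,
      not_lt]
    exact ⟨fun h => h.antisymm M.rank_le_card_height, fun h => h.le⟩
  rw [← not_iff_not, hind, ← Matrix.vecMul_injective_iff, ← Matrix.coe_vecMulLinear,
    injective_iff_map_eq_zero]
  simp only [Matrix.vecMulLinear_apply]
  grind

lemma adjMat2_symm {n : ℕ} (G : SimpleGraph (Fin n)) [DecidableRel G.Adj] (a b : Fin n) :
    adjMat2 G a b = adjMat2 G b a := by
  simp [adjMat2, G.adj_comm]

/-- `Γ⟨A⟩` has dependent rows iff some nonzero `x` is supported in `A` together with `Γ x`. -/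
lemma rank_adjCut_lt_card_iff {n : ℕ} (G : SimpleGraph (Fin n)) [DecidableRel G.Adj]
    (A : Finset (Fin n)) :
    (adjCut G A).rank < A.card ↔ ∃ x : Fin n → ZMod 2, (∃ i, x i ≠ 0) ∧
      ∀ i ∉ A, x i = 0 ∧ ∑ b, x b * adjMat2 G i b = 0 := by
  have hcut (x : Fin n → ZMod 2) (hx : ∀ i ∉ A, x i = 0) (i : {b // b ∉ A}) :
      ((fun a : {a // a ∈ A} => x a) ᵥ* adjCut G A) i = ∑ b, x b * adjMat2 G i b := by
    simp only [Matrix.vecMul, dotProduct, adjCut, Matrix.of_apply, adjMat2_symm G i]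
    rw [← Finset.sum_subset (Finset.subset_univ A) fun b _ hb => by rw [hx b hb, zero_mul]]
    exact Finset.sum_coe_sort A fun b => x b * adjMat2 G b i
  rw [← Fintype.card_coe A, rank_lt_card_iff_exists_vecMul_eq_zero]
  constructor
  · rintro ⟨y, hy, hyM⟩
    set x : Fin n → ZMod 2 := fun i => if h : i ∈ A then y ⟨i, h⟩ else 0 with hxdef
    have hx : ∀ i ∉ A, x i = 0 := fun i hi => by simp [hxdef, hi]
    have hxy : (fun a : {a // a ∈ A} => x a) = y := funext fun a => by simp [hxdef]
    obtain ⟨a, ha⟩ := Function.ne_iff.1 hy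
    refine ⟨x, ⟨a, by simpa [← hxy] using ha⟩, fun i hi => ⟨hx i hi, ?_⟩⟩
    rw [← hcut x hx ⟨i, hi⟩, hxy, hyM, Pi.zero_apply]
  · rintro ⟨x, ⟨i, hi⟩, hx⟩
    have hiA : i ∈ A := by
      by_contra h
      exact hi (hx i h).1
    refine ⟨fun a => x a, Function.ne_iff.2 ⟨⟨i, hiA⟩, hi⟩, funext fun b => ?_⟩
    rw [hcut x fun i hi => (hx i hi).1]
    exact (hx b b.2).2

/-- for a connected graph `G` on `n ≥ 3` vertices with graph state `|G⟩`,
`δ(|G⟩)` equals the smallest cardinality `|A|` of a set `A ⊆ V` of vertices such that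
`|A| > rank₂ Γ⟨A⟩`. -/
theorem delta_eq_min_card_rank_deficient
    {n : ℕ} (hn : 3 ≤ n) (G : SimpleGraph (Fin n)) [DecidableRel G.Adj]
    (hG : G.Connected) (ψ : QState n) (hψ : IsGraphState G ψ) :
    deltaG ψ = sInf {k | ∃ A : Finset (Fin n), A.card = k ∧ (adjCut G A).rank < A.card} := by
  apply le_antisymm
  · have hne : {k | ∃ A : Finset (Fin n), A.card = k ∧ (adjCut G A).rank < A.card}.Nonempty := by
      refine ⟨_, Finset.univ, rfl, (rank_adjCut_lt_card_iff G _).2 ⟨1, ⟨⟨0, by omega⟩, ?_⟩, ?_⟩⟩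
      · simp
      · simp
    obtain ⟨A, hA, hrank⟩ := Nat.sInf_mem hne
    obtain ⟨x, ⟨i, hi⟩, hx⟩ := (rank_adjCut_lt_card_iff G A).1 hrank
    obtain ⟨g, f, hg, hgf, hxf⟩ := hψ.exists_mem_stab x
    obtain ⟨c, hc, hf⟩ := hgf.mulVec_eq hg.2
    have hne_one : g ≠ 1 := (hψ.ne_one_iff hg.2 hgf).2 ⟨i, by rwa [hxf]⟩
    have hle : deltaG ψ ≤ pWeight f := Nat.sInf_le ⟨g, hg, hne_one, f, hgf, rfl⟩
    rw [← hA]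
    refine hle.trans (Finset.card_le_card fun j hj => ?_)
    by_contra hjA
    refine (Finset.mem_filter.1 hj).2 ((eq_zero_iff_xBit_zBit _).2 ⟨?_, ?_⟩)
    · rw [hxf, (hx j hjA).1]
    · simpa only [hψ.zBit_eq hc hf, hxf] using (hx j hjA).2
  · have hne : {d | ∃ g ∈ stab ψ, g ≠ 1 ∧ ∃ f, IsSignedPauli g f ∧ pWeight f = d}.Nonempty := by
      obtain ⟨g, f, hg, hgf, hxf⟩ := hψ.exists_mem_stab 1
      exact ⟨_, g, hg, (hψ.ne_one_iff hg.2 hgf).2 ⟨⟨0, by omega⟩, by simp [hxf]⟩, f, hgf, rfl⟩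
    obtain ⟨g, hg, hne_one, f, hgf, hd⟩ := Nat.sInf_mem hne
    obtain ⟨c, hc, hf⟩ := hgf.mulVec_eq hg.2
    refine Nat.sInf_le ⟨pSupport f, hd, (rank_adjCut_lt_card_iff G _).2
      ⟨fun i => xBit (f i), (hψ.ne_one_iff hg.2 hgf).1 hne_one, fun i hi => ?_⟩⟩
    have hfi : f i = 0 := by simpa [pSupport] using hi
    rw [← hψ.zBit_eq hc hf]
    exact (eq_zero_iff_xBit_zBit _).1 hfi
end
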